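/- arXiv:1704.00847 — 6 statements merged into one kernel-verified Lean document; each statement's English description precedes it below -/
import Mathlib

section
/- Suppose G : [0,∞) → [0,∞) is continuous, bounded and strictly positive definite. Then the cost functional C admits at most one minimizer over the set Ξ(x) of deterministic admissible strategies with fuel constraint. -/
open MeasureTheory

/-- Integral of a real function against a finite signed Borel measure,
via its Jordan decomposition. -/
noncomputable def sint (ν : SignedMeasure ℝ) (f : ℝ → ℝ) : ℝ :=
  (∫ t, f t ∂ν.toJordanDecomposition.posPart) -
    ∫ t, f t ∂ν.toJordanDecomposition.negPart

/-- The set Ξ(x) of deterministic admissible strategies: finite signed Borel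
measures supported in `[0,T]` with total mass `-x`. -/
def Xi (T x : ℝ) : Set (SignedMeasure ℝ) :=
  {μ | (∀ s : Set ℝ, s ∩ Set.Icc 0 T = ∅ → μ s = 0) ∧ μ Set.univ = -x}

namespace Aux

noncomputable abbrev P (μ : SignedMeasure ℝ) : Measure ℝ := μ.toJordanDecomposition.posPart
noncomputable abbrev N (μ : SignedMeasure ℝ) : Measure ℝ := μ.toJordanDecomposition.negPart

lemma app (μ : SignedMeasure ℝ) {s : Set ℝ} (hs : MeasurableSet s) :
    μ s = (P μ).real s - (N μ).real s := by
  conv_lhs => rw [← μ.toSignedMeasure_toJordanDecomposition]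
  rw [JordanDecomposition.toSignedMeasure, VectorMeasure.sub_apply,
    Measure.toSignedMeasure_apply_measurable hs, Measure.toSignedMeasure_apply_measurable hs]

/-- bounded measurable -/
def BM (f : ℝ → ℝ) : Prop := Measurable f ∧ ∃ M, ∀ t, |f t| ≤ M

lemma BM.int {f : ℝ → ℝ} (hf : BM f) (m : Measure ℝ) [IsFiniteMeasure m] : Integrable f m := by
  obtain ⟨h1, M, hM⟩ := hf
  exact Integrable.of_bound h1.aestronglyMeasurable M (Filter.Eventually.of_forall hM)

lemma meas_add (μ ν : SignedMeasure ℝ) :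
    P (μ + ν) + (N μ + N ν) = N (μ + ν) + (P μ + P ν) := by
  ext s hs
  have h1 := app (μ + ν) hs
  rw [VectorMeasure.add_apply, app μ hs, app ν hs] at h1
  have : (P (μ + ν) + (N μ + N ν)).real s = (N (μ + ν) + (P μ + P ν)).real s := by
    rw [measureReal_add_apply (by finiteness) (by finiteness), measureReal_add_apply (by finiteness) (by finiteness),
      measureReal_add_apply (by finiteness) (by finiteness), measureReal_add_apply (by finiteness) (by finiteness)]
    linarith
  exact (measureReal_eq_measureReal_iff (by finiteness) (by finiteness)).1 this

lemma sint_add (μ ν : SignedMeasure ℝ) {f : ℝ → ℝ} (hf : BM f) :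
    sint (μ + ν) f = sint μ f + sint ν f := by
  have h := congrArg (fun m => ∫ t, f t ∂m) (meas_add μ ν)
  rw [integral_add_measure (hf.int _) (hf.int _), integral_add_measure (hf.int _) (hf.int _),
    integral_add_measure (hf.int _) (hf.int _), integral_add_measure (hf.int _) (hf.int _)] at h
  unfold sint
  simp only [P, N] at h
  linarith

lemma sint_fadd (μ : SignedMeasure ℝ) {f g : ℝ → ℝ} (hf : BM f) (hg : BM g) :
    sint μ (fun t => f t + g t) = sint μ f + sint μ g := by
  unfold sint
  rw [integral_add (hf.int _) (hg.int _), integral_add (hf.int _) (hg.int _)]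
  ring

lemma supp {T : ℝ} {μ : SignedMeasure ℝ} (h : ∀ s : Set ℝ, s ∩ Set.Icc 0 T = ∅ → μ s = 0) :
    P μ (Set.Icc 0 T)ᶜ = 0 ∧ N μ (Set.Icc 0 T)ᶜ = 0 := by
  obtain ⟨i, hi, h1, h2, h3, h4⟩ := μ.toJordanDecomposition_spec
  have hm : MeasurableSet (Set.Icc 0 T)ᶜ := measurableSet_Icc.compl
  constructor
  · rw [P, h3, SignedMeasure.toMeasureOfZeroLE_apply _ h1 hi hm]
    have : μ (i ∩ (Set.Icc 0 T)ᶜ) = 0 := h _ (by ext; simp)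
    simp [this]
  · rw [N, h4, SignedMeasure.toMeasureOfLEZero_apply _ h2 hi.compl hm]
    have : μ (iᶜ ∩ (Set.Icc 0 T)ᶜ) = 0 := h _ (by ext; simp)
    simp [this]

lemma sint_congr {T : ℝ} {μ : SignedMeasure ℝ}
    (h : ∀ s : Set ℝ, s ∩ Set.Icc 0 T = ∅ → μ s = 0) {f g : ℝ → ℝ}
    (hfg : ∀ t ∈ Set.Icc 0 T, f t = g t) : sint μ f = sint μ g := by
  obtain ⟨h1, h2⟩ := supp h
  unfold sint
  congr 1
  · apply integral_congr_ae
    filter_upwards [mem_ae_iff.2 h1] with t ht using hfg t ht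
  · apply integral_congr_ae
    filter_upwards [mem_ae_iff.2 h2] with t ht using hfg t ht

lemma BM_sint {K : ℝ → ℝ → ℝ} (hK : Measurable (Function.uncurry K)) {M : ℝ}
    (hM : ∀ t s, |K t s| ≤ M) (μ : SignedMeasure ℝ) : BM (fun t => sint μ (K t)) := by
  constructor
  · unfold sint
    exact (hK.stronglyMeasurable.integral_prod_right.measurable).sub
      (hK.stronglyMeasurable.integral_prod_right.measurable)
  · refine ⟨M * (P μ).real Set.univ + M * (N μ).real Set.univ, fun t => ?_⟩
    unfold sint
    refine (abs_sub _ _).trans (add_le_add ?_ ?_)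
    · exact norm_integral_le_of_norm_le_const (Filter.Eventually.of_forall (fun s => (Real.norm_eq_abs (K t s)).trans_le (hM t s)))
    · exact norm_integral_le_of_norm_le_const (Filter.Eventually.of_forall (fun s => (Real.norm_eq_abs (K t s)).trans_le (hM t s)))

lemma BM_inv (x : ℝ) (μ : SignedMeasure ℝ) : BM (fun t => x + μ (Set.Ico 0 t)) := by
  have e : (fun t => x + μ (Set.Ico 0 t)) =
      fun t => x + ((P μ).real (Set.Ico 0 t) - (N μ).real (Set.Ico 0 t)) := by
    ext t; rw [app μ measurableSet_Ico]
  have mono : ∀ (m : Measure ℝ) [IsFiniteMeasure m], Measurable fun t => m.real (Set.Ico 0 t) := by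
    intro m _
    exact Monotone.measurable fun a b hab => measureReal_mono (Set.Ico_subset_Ico_right hab)
  rw [e]
  refine ⟨((mono _).sub (mono _)).const_add _,
    |x| + ((P μ).real Set.univ + (N μ).real Set.univ), fun t => ?_⟩
  refine (abs_add_le _ _).trans (add_le_add le_rfl ((abs_sub _ _).trans (add_le_add ?_ ?_)))
  · rw [abs_of_nonneg measureReal_nonneg]; exact measureReal_mono (Set.subset_univ _)
  · rw [abs_of_nonneg measureReal_nonneg]; exact measureReal_mono (Set.subset_univ _)

lemma BM.sq {f : ℝ → ℝ} (hf : BM f) : BM (fun t => f t ^ 2) := by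
  obtain ⟨h, M, hM⟩ := hf
  refine ⟨h.pow_const 2, M ^ 2, fun t => ?_⟩
  rw [abs_pow]
  exact pow_le_pow_left₀ (abs_nonneg _) (hM t) 2

lemma exists_H {T : ℝ} {h : ℝ → ℝ} (hh : IntegrableOn h (Set.Icc 0 T)) :
    ∃ H : ℝ → ℝ, BM H ∧ ∀ t ∈ Set.Icc 0 T, (∫ s in (0:ℝ)..t, h s) = H t := by
  have hi : Integrable ((Set.Icc 0 T).indicator h) := (integrable_indicator_iff measurableSet_Icc).2 hh
  refine ⟨fun t => ∫ s in (0:ℝ)..t, (Set.Icc 0 T).indicator h s, ⟨?_, ?_⟩, ?_⟩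
  · exact (intervalIntegral.continuous_primitive
      (fun a b => hi.intervalIntegrable) 0).measurable
  · refine ⟨∫ s, ‖(Set.Icc 0 T).indicator h s‖, fun t => ?_⟩
    rw [← Real.norm_eq_abs]
    refine (intervalIntegral.norm_integral_le_integral_norm_uIoc).trans ?_
    exact setIntegral_le_integral hi.norm (Filter.Eventually.of_forall fun _ => norm_nonneg _)
  · intro t ht
    apply intervalIntegral.integral_congr
    intro s hs
    rw [Set.uIcc_of_le ht.1] at hs
    have hs2 : s ∈ Set.Icc 0 T := ⟨hs.1, hs.2.trans ht.2⟩
    exact (Set.indicator_of_mem hs2 h).symm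

end Aux

/-- If `G : [0,∞) → [0,∞)` is continuous, bounded and strictly positive definite,
then the cost functional `C` admits at most one minimizer over `Ξ(x)`. -/
theorem stmt_0 (T x φ : ℝ) (hT : 0 < T) (hφ : 0 ≤ φ)
    (h : ℝ → ℝ) (hh : IntegrableOn h (Set.Icc 0 T))
    (G : ℝ → ℝ)
    (hGnonneg : ∀ t, 0 ≤ t → 0 ≤ G t)
    (hGcont : ContinuousOn G (Set.Ici 0))
    (hGbdd : ∃ M : ℝ, ∀ t, 0 ≤ t → G t ≤ M)
    (hGspd : ∀ ν : SignedMeasure ℝ,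
      (∀ s : Set ℝ, s ∩ Set.Icc 0 T = ∅ → ν s = 0) → ν ≠ 0 →
      0 < sint ν (fun t => sint ν (fun s => G |t - s|)))
    (C : SignedMeasure ℝ → ℝ)
    (hC : ∀ μ : SignedMeasure ℝ, C μ =
      sint μ (fun t => ∫ s in (0:ℝ)..t, h s)
        + (1/2) * sint μ (fun t => sint μ (fun s => G |t - s|))
        + φ * ∫ t in (0:ℝ)..T, (x + μ (Set.Ico 0 t))^2) :
    ∀ μ ν : SignedMeasure ℝ, μ ∈ Xi T x → ν ∈ Xi T x →
      (∀ η ∈ Xi T x, C μ ≤ C η) → (∀ η ∈ Xi T x, C ν ≤ C η) → μ = ν := by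
  intro μ ν hμ hν hμm hνm
  by_contra hne
  obtain ⟨M, hM⟩ := hGbdd
  have hKm : Measurable (Function.uncurry (fun t s : ℝ => G |t - s|)) := by
    have : Continuous (fun p : ℝ × ℝ => G |p.1 - p.2|) :=
      hGcont.comp_continuous (by fun_prop) (fun p => Set.mem_Ici.2 (abs_nonneg _))
    exact this.measurable
  have hKb : ∀ t s : ℝ, abs (G (abs (t - s))) ≤ M := fun t s => by
    rw [abs_of_nonneg (hGnonneg _ (abs_nonneg _))]; exact hM _ (abs_nonneg _)
  have hKt : ∀ t : ℝ, Aux.BM (fun s => G |t - s|) := fun t =>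
    ⟨hKm.comp measurable_prodMk_left, M, hKb t⟩
  have hF : ∀ a : SignedMeasure ℝ, Aux.BM (fun t => sint a (fun s => G |t - s|)) := fun a =>
    Aux.BM_sint hKm hKb a
  obtain ⟨H, hH, hHe⟩ := Aux.exists_H hh
  set B : SignedMeasure ℝ → SignedMeasure ℝ → ℝ :=
    fun a b => sint a (fun t => sint b (fun s => G |t - s|)) with hB
  have B1 : ∀ a b c, B (a + b) c = B a c + B b c := fun a b c => Aux.sint_add a b (hF c)
  have B2 : ∀ a b c, B a (b + c) = B a b + B a c := fun a b c => by
    simp only [hB]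
    rw [← Aux.sint_fadd a (hF b) (hF c)]
    congr 1
    ext t
    exact Aux.sint_add b c (hKt t)
  set η : SignedMeasure ℝ := (1/2 : ℝ) • (μ + ν) with hη
  have hηη : η + η = μ + ν := by
    rw [hη, ← add_smul]; norm_num
  have hηa : ∀ s, η s = (1/2) * (μ s + ν s) := fun s => by
    rw [hη, VectorMeasure.smul_apply, VectorMeasure.add_apply, smul_eq_mul]
  have hηX : η ∈ Xi T x := by
    refine ⟨fun s hs => ?_, ?_⟩
    · rw [hηa, hμ.1 s hs, hν.1 s hs]; ring
    · rw [hηa, hμ.2, hν.2]; ring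
  have hδ := hGspd (μ - ν)
    (fun s hs => by rw [VectorMeasure.sub_apply, hμ.1 s hs, hν.1 s hs]; ring)
    (sub_ne_zero.2 hne)
  change 0 < B (μ - ν) (μ - ν) at hδ
  have eB : 4 * B η η + B (μ - ν) (μ - ν) = 2 * B μ μ + 2 * B ν ν := by
    have e1 : B (η + η) (η + η) = B (μ + ν) (μ + ν) := by rw [hηη]
    rw [B1, B2, B1, B2, B2] at e1
    have d : μ - ν + ν = μ := sub_add_cancel _ _
    have e2 : B (μ - ν + ν) ν = B μ ν := by rw [d]
    have e3 : B ν (μ - ν + ν) = B ν μ := by rw [d]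
    have e4 : B (μ - ν + ν) (μ - ν + ν) = B μ μ := by rw [d]
    rw [B1] at e2
    rw [B2] at e3
    rw [B1, B2, B2] at e4
    linarith
  have eH : 2 * sint η H = sint μ H + sint ν H := by
    rw [← Aux.sint_add μ ν hH, ← hηη, Aux.sint_add η η hH]; ring
  have eQ : 2 * ∫ t in (0:ℝ)..T, (x + η (Set.Ico 0 t))^2 ≤
      (∫ t in (0:ℝ)..T, (x + μ (Set.Ico 0 t))^2) + ∫ t in (0:ℝ)..T, (x + ν (Set.Ico 0 t))^2 := by
    have hint : ∀ a : SignedMeasure ℝ,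
        IntervalIntegrable (fun t => (x + a (Set.Ico 0 t))^2) volume 0 T := fun a =>
      ⟨(Aux.BM_inv x a).sq.int _, (Aux.BM_inv x a).sq.int _⟩
    rw [← intervalIntegral.integral_const_mul,
      ← intervalIntegral.integral_add (hint μ) (hint ν)]
    apply intervalIntegral.integral_mono_on hT.le ((hint η).const_mul 2) ((hint μ).add (hint ν))
    intro t _
    rw [hηa]
    nlinarith [sq_nonneg (μ (Set.Ico 0 t) - ν (Set.Ico 0 t))]
  have cμ := hC μ
  have cν := hC ν
  have cη := hC η
  rw [Aux.sint_congr hμ.1 hHe] at cμ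
  rw [Aux.sint_congr hν.1 hHe] at cν
  rw [Aux.sint_congr hηX.1 hHe] at cη
  change _ = _ + 1/2 * B μ μ + _ at cμ
  change _ = _ + 1/2 * B ν ν + _ at cν
  change _ = _ + 1/2 * B η η + _ at cη
  have q := mul_le_mul_of_nonneg_left eQ hφ
  have m1 := hμm η hηX
  have m2 := hνm η hηX
  linarith
end

section
/- Suppose G : [0,∞) → [0,∞) is continuous, bounded and strictly positive definite. Then the cost functional C is strictly convex on Ξ(x): for any two distinct measures μ, ν ∈ Ξ(x) and any α ∈ (0,1), C(αμ + (1-α)ν) < α C(μ) + (1-α) C(ν). -/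
open MeasureTheory

lemma aux_eq (ν : SignedMeasure ℝ) (p q : Measure ℝ) [IsFiniteMeasure p] [IsFiniteMeasure q]
    (h : ν = p.toSignedMeasure - q.toSignedMeasure) (f : ℝ → ℝ) (hf : Continuous f)
    (M : ℝ) (hM : ∀ t, |f t| ≤ M) :
    sint ν f = (∫ t, f t ∂p) - ∫ t, f t ∂q := by
  have hi : ∀ (m : Measure ℝ) [IsFiniteMeasure m], Integrable f m := fun m _ =>
    Integrable.of_bound hf.aestronglyMeasurable M (Filter.Eventually.of_forall hM)
  have e : ν.toJordanDecomposition.posPart + q = p + ν.toJordanDecomposition.negPart := by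
    have h1 := ν.toSignedMeasure_toJordanDecomposition
    unfold JordanDecomposition.toSignedMeasure at h1
    have h2 : ν.toJordanDecomposition.posPart.toSignedMeasure + q.toSignedMeasure
        = p.toSignedMeasure + ν.toJordanDecomposition.negPart.toSignedMeasure := by
      rw [← sub_eq_sub_iff_add_eq_add, h1, h]
    rw [← Measure.toSignedMeasure_add, ← Measure.toSignedMeasure_add] at h2
    exact Measure.toSignedMeasure_eq_toSignedMeasure_iff.1 h2
  have e2 := congrArg (fun m => ∫ t, f t ∂m) e
  rw [integral_add_measure (hi _) (hi _), integral_add_measure (hi _) (hi _)] at e2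
  unfold sint
  linarith

lemma jd (ν : SignedMeasure ℝ) : ν = ν.toJordanDecomposition.posPart.toSignedMeasure -
    ν.toJordanDecomposition.negPart.toSignedMeasure :=
  ν.toSignedMeasure_toJordanDecomposition.symm

lemma sint_add (μ ν : SignedMeasure ℝ) (f : ℝ → ℝ) (hf : Continuous f)
    (M : ℝ) (hM : ∀ t, |f t| ≤ M) : sint (μ + ν) f = sint μ f + sint ν f := by
  have hi : ∀ (m : Measure ℝ) [IsFiniteMeasure m], Integrable f m := fun m _ =>
    Integrable.of_bound hf.aestronglyMeasurable M (Filter.Eventually.of_forall hM)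
  rw [aux_eq (μ + ν) (μ.toJordanDecomposition.posPart + ν.toJordanDecomposition.posPart)
    (μ.toJordanDecomposition.negPart + ν.toJordanDecomposition.negPart) ?_ f hf M hM,
    integral_add_measure (hi _) (hi _), integral_add_measure (hi _) (hi _)]
  · unfold sint; ring
  · rw [Measure.toSignedMeasure_add, Measure.toSignedMeasure_add]
    conv_lhs => rw [jd μ, jd ν]
    abel

lemma sint_neg (μ : SignedMeasure ℝ) (f : ℝ → ℝ) : sint (-μ) f = - sint μ f := by
  unfold sint
  rw [SignedMeasure.toJordanDecomposition_neg]
  simp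

lemma sint_smul (μ : SignedMeasure ℝ) (a : ℝ) (f : ℝ → ℝ) : sint (a • μ) f = a * sint μ f := by
  have key : ∀ (b : NNReal), sint (b • μ) f = b * sint μ f := by
    intro b
    unfold sint
    rw [SignedMeasure.toJordanDecomposition_smul]
    simp only [JordanDecomposition.smul_posPart, JordanDecomposition.smul_negPart,
      integral_smul_nnreal_measure, NNReal.smul_def, smul_eq_mul]
    ring
  rcases le_total 0 a with h | h
  · exact key ⟨a, h⟩
  · have h1 : sint ((-a) • μ) f = -a * sint μ f := key ⟨-a, by linarith⟩
    have h2 : (-a) • μ = -(a • μ) := by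
      ext i _
      simp
    rw [h2, sint_neg] at h1
    linarith

lemma sint_lin (μ ν : SignedMeasure ℝ) (a b : ℝ) (f : ℝ → ℝ) (hf : Continuous f)
    (M : ℝ) (hM : ∀ t, |f t| ≤ M) :
    sint (a • μ + b • ν) f = a * sint μ f + b * sint ν f := by
  rw [sint_add _ _ f hf M hM, sint_smul, sint_smul]

lemma sint_fun_lin (μ : SignedMeasure ℝ) (a b : ℝ) (f g : ℝ → ℝ) (hf : Continuous f)
    (M : ℝ) (hM : ∀ t, |f t| ≤ M) (hg : Continuous g) (N : ℝ) (hN : ∀ t, |g t| ≤ N) :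
    sint μ (fun t => a * f t + b * g t) = a * sint μ f + b * sint μ g := by
  have hi : ∀ (m : Measure ℝ) [IsFiniteMeasure m], Integrable f m := fun m _ =>
    Integrable.of_bound hf.aestronglyMeasurable M (Filter.Eventually.of_forall hM)
  have hj : ∀ (m : Measure ℝ) [IsFiniteMeasure m], Integrable g m := fun m _ =>
    Integrable.of_bound hg.aestronglyMeasurable N (Filter.Eventually.of_forall hN)
  unfold sint
  rw [integral_add ((hi _).const_mul a) ((hj _).const_mul b),
    integral_add ((hi _).const_mul a) ((hj _).const_mul b)]
  simp only [integral_const_mul]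
  ring

lemma supp_null (T : ℝ) (μ : SignedMeasure ℝ)
    (h : ∀ s : Set ℝ, s ∩ Set.Icc 0 T = ∅ → μ s = 0) :
    μ.toJordanDecomposition.posPart (Set.Icc 0 T)ᶜ = 0 ∧
    μ.toJordanDecomposition.negPart (Set.Icc 0 T)ᶜ = 0 := by
  obtain ⟨i, hi, h1, h2, hp, hn⟩ := μ.toJordanDecomposition_spec
  have hm : MeasurableSet (Set.Icc (0:ℝ) T)ᶜ := measurableSet_Icc.compl
  rw [hp, hn, SignedMeasure.toMeasureOfZeroLE_apply _ _ hi hm,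
    SignedMeasure.toMeasureOfLEZero_apply _ _ hi.compl hm]
  have e1 : μ (i ∩ (Set.Icc 0 T)ᶜ) = 0 := h _ (by ext; simp)
  have e2 : μ (iᶜ ∩ (Set.Icc 0 T)ᶜ) = 0 := h _ (by ext; simp)
  simp [e1, e2]

lemma sint_congr (T : ℝ) (μ : SignedMeasure ℝ)
    (h : ∀ s : Set ℝ, s ∩ Set.Icc 0 T = ∅ → μ s = 0) (f g : ℝ → ℝ)
    (hfg : ∀ t ∈ Set.Icc 0 T, f t = g t) : sint μ f = sint μ g := by
  obtain ⟨h1, h2⟩ := supp_null T μ h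
  unfold sint
  congr 1
  · apply integral_congr_ae
    filter_upwards [measure_eq_zero_iff_ae_notMem.1 h1] with t ht
    exact hfg t (by simpa using ht)
  · apply integral_congr_ae
    filter_upwards [measure_eq_zero_iff_ae_notMem.1 h2] with t ht
    exact hfg t (by simpa using ht)

lemma sint_cont (μ : SignedMeasure ℝ) (K : ℝ → ℝ → ℝ) (hK : Continuous (fun p : ℝ × ℝ => K p.1 p.2))
    (M : ℝ) (hM : ∀ t s, |K t s| ≤ M) :
    Continuous (fun t => sint μ (K t)) ∧ ∃ N, ∀ t, |sint μ (K t)| ≤ N := by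
  have c : ∀ (m : Measure ℝ) [IsFiniteMeasure m], Continuous (fun t => ∫ s, K t s ∂m) := by
    intro m _
    apply continuous_of_dominated (bound := fun _ => M)
    · intro t
      exact (hK.comp (Continuous.prodMk_right t)).aestronglyMeasurable
    · intro t; exact Filter.Eventually.of_forall (hM t)
    · exact integrable_const M
    · exact Filter.Eventually.of_forall fun s => hK.comp (Continuous.prodMk_left s)
  have b : ∀ (m : Measure ℝ) [IsFiniteMeasure m] t, |∫ s, K t s ∂m| ≤ M * m.real Set.univ := by
    intro m _ t
    exact norm_integral_le_of_norm_le_const (f := fun s => K t s) (Filter.Eventually.of_forall (hM t))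
  refine ⟨(c _).sub (c _), M * μ.toJordanDecomposition.posPart.real Set.univ +
    M * μ.toJordanDecomposition.negPart.real Set.univ, fun t => (abs_sub _ _).trans (add_le_add (b _ t) (b _ t))⟩

lemma inv_int (T x : ℝ) (μ : SignedMeasure ℝ) :
    IntervalIntegrable (fun t => (x + μ (Set.Ico 0 t))^2) volume 0 T := by
  have mono : ∀ (m : Measure ℝ) [IsFiniteMeasure m], Monotone (fun t => m.real (Set.Ico 0 t)) :=
    fun m _ s t hst => measureReal_mono (Set.Ico_subset_Ico_right hst)
  have e : ∀ t, μ (Set.Ico 0 t) = μ.toJordanDecomposition.posPart.real (Set.Ico 0 t) -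
      μ.toJordanDecomposition.negPart.real (Set.Ico 0 t) := by
    intro t
    conv_lhs => rw [jd μ]
    simp [Measure.toSignedMeasure_apply]
  have b : ∀ (m : Measure ℝ) [IsFiniteMeasure m] t, |m.real (Set.Ico 0 t)| ≤ m.real Set.univ := by
    intro m _ t
    rw [abs_of_nonneg measureReal_nonneg]
    exact measureReal_mono (Set.subset_univ _)
  simp only [e]
  set p := μ.toJordanDecomposition.posPart
  set q := μ.toJordanDecomposition.negPart
  have hb : ∀ t, ‖(x + (p.real (Set.Ico 0 t) - q.real (Set.Ico 0 t)))^2‖ ≤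
      (|x| + (p.real Set.univ + q.real Set.univ))^2 := by
    intro t
    rw [norm_pow]
    gcongr
    exact (abs_add_le _ _).trans (by gcongr; exact (abs_sub _ _).trans (add_le_add (b p t) (b q t)))
  rw [intervalIntegrable_iff, Set.uIoc]
  refine Integrable.of_bound ?_ _ (Filter.Eventually.of_forall hb)
  exact (((mono p).measurable.sub (mono q).measurable).const_add x |>.pow_const 2).aestronglyMeasurable

/-- If `G : [0,∞) → [0,∞)` is continuous, bounded and strictly positive definite,
then the cost functional `C` is strictly convex on `Ξ(x)`. -/
theorem stmt_1 (T x φ : ℝ) (hT : 0 < T) (hφ : 0 ≤ φ)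
    (h : ℝ → ℝ) (hh : IntegrableOn h (Set.Icc 0 T))
    (G : ℝ → ℝ)
    (hGnonneg : ∀ t, 0 ≤ t → 0 ≤ G t)
    (hGcont : ContinuousOn G (Set.Ici 0))
    (hGbdd : ∃ M : ℝ, ∀ t, 0 ≤ t → G t ≤ M)
    (hGspd : ∀ ν : SignedMeasure ℝ,
      (∀ s : Set ℝ, s ∩ Set.Icc 0 T = ∅ → ν s = 0) → ν ≠ 0 →
      0 < sint ν (fun t => sint ν (fun s => G |t - s|)))
    (C : SignedMeasure ℝ → ℝ)
    (hC : ∀ μ : SignedMeasure ℝ, C μ =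
      sint μ (fun t => ∫ s in (0:ℝ)..t, h s)
        + (1/2) * sint μ (fun t => sint μ (fun s => G |t - s|))
        + φ * ∫ t in (0:ℝ)..T, (x + μ (Set.Ico 0 t))^2) :
    ∀ μ ν : SignedMeasure ℝ, μ ∈ Xi T x → ν ∈ Xi T x → μ ≠ ν →
      ∀ α : ℝ, 0 < α → α < 1 →
        C (α • μ + (1 - α) • ν) < α * C μ + (1 - α) * C ν := by
  intro μ ν hμ hν hne α h0 h1
  obtain ⟨M, hM⟩ := hGbdd
  have hKc : Continuous (fun p : ℝ × ℝ => G |p.1 - p.2|) :=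
    hGcont.comp_continuous (by fun_prop) (fun p => Set.mem_Ici.2 (abs_nonneg _))
  have hKb : ∀ t s : ℝ, |(G (|t - s|))| ≤ M := fun t s => by
    rw [abs_of_nonneg (hGnonneg _ (abs_nonneg _))]
    exact hM _ (abs_nonneg _)
  have hKt : ∀ t : ℝ, Continuous (fun s => G |t - s|) := fun t =>
    hKc.comp (Continuous.prodMk_right t)
  have hB : ∀ (μ ν : SignedMeasure ℝ) (a b : ℝ),
      sint (a • μ + b • ν) (fun t => sint (a • μ + b • ν) (fun s => G |t - s|)) =
      a * a * sint μ (fun t => sint μ (fun s => G |t - s|)) +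
      a * b * sint μ (fun t => sint ν (fun s => G |t - s|)) +
      a * b * sint ν (fun t => sint μ (fun s => G |t - s|)) +
      b * b * sint ν (fun t => sint ν (fun s => G |t - s|)) := by
    intro μ ν a b
    obtain ⟨c0, N0, b0⟩ := sint_cont (a • μ + b • ν) (fun t s => G |t - s|) hKc M hKb
    obtain ⟨c1, N1, b1⟩ := sint_cont μ (fun t s => G |t - s|) hKc M hKb
    obtain ⟨c2, N2, b2⟩ := sint_cont ν (fun t s => G |t - s|) hKc M hKb
    rw [sint_lin μ ν a b _ c0 N0 b0]
    have : (fun t => sint (a • μ + b • ν) (fun s => G |t - s|)) =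
      fun t => a * sint μ (fun s => G |t - s|) + b * sint ν (fun s => G |t - s|) :=
      funext fun t => sint_lin μ ν a b _ (hKt t) M (hKb t)
    rw [this, sint_fun_lin μ a b _ _ c1 N1 b1 c2 N2 b2, sint_fun_lin ν a b _ _ c1 N1 b1 c2 N2 b2]
    ring
  have hsupp : ∀ (a b : ℝ) (s : Set ℝ), s ∩ Set.Icc 0 T = ∅ → (a • μ + b • ν) s = 0 := by
    intro a b s hs
    simp [hμ.1 s hs, hν.1 s hs]
  -- quadratic term
  have hQ := hB μ ν α (1 - α)
  have hD := hB μ ν 1 (-1)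
  have hpos := hGspd ((1:ℝ) • μ + (-1:ℝ) • ν) (hsupp 1 (-1)) (by
    intro h
    apply hne
    ext i _
    have h2 : ((1:ℝ) • μ + (-1:ℝ) • ν) i = 0 := by rw [h]; rfl
    simp at h2
    linarith)
  -- linear term
  have hL : sint (α • μ + (1 - α) • ν) (fun t => ∫ s in (0:ℝ)..t, h s) =
      α * sint μ (fun t => ∫ s in (0:ℝ)..t, h s) +
      (1 - α) * sint ν (fun t => ∫ s in (0:ℝ)..t, h s) := by
    set H : ℝ → ℝ := Set.IccExtend hT.le
      (fun t : Set.Icc (0:ℝ) T => ∫ s in (0:ℝ)..t, h s) with hH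
    have hcon : ContinuousOn (fun t => ∫ s in (0:ℝ)..t, h s) (Set.Icc 0 T) := by
      have := intervalIntegral.continuousOn_primitive_interval (μ := volume) (f := h) (a := 0) (b := T)
        (by rwa [Set.uIcc_of_le hT.le])
      rwa [Set.uIcc_of_le hT.le] at this
    have hHc : Continuous H := hcon.domRestrict.Icc_extend'
    obtain ⟨N, hN⟩ := isCompact_Icc.exists_bound_of_continuousOn hcon
    have hHb : ∀ t, |H t| ≤ N := fun t => hN _ (Set.projIcc 0 T hT.le t).2
    have hEq : ∀ t ∈ Set.Icc 0 T, (∫ s in (0:ℝ)..t, h s) = H t := fun t ht => by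
      rw [hH, Set.IccExtend_of_mem _ _ ht]
    rw [sint_congr T _ (hsupp _ _) _ H hEq, sint_congr T μ hμ.1 _ H hEq,
      sint_congr T ν hν.1 _ H hEq, sint_lin μ ν _ _ H hHc N hHb]
  -- inventory term
  have hI : (∫ t in (0:ℝ)..T, (x + (α • μ + (1 - α) • ν) (Set.Ico 0 t))^2) ≤
      α * (∫ t in (0:ℝ)..T, (x + μ (Set.Ico 0 t))^2) +
      (1 - α) * ∫ t in (0:ℝ)..T, (x + ν (Set.Ico 0 t))^2 := by
    rw [← intervalIntegral.integral_const_mul, ← intervalIntegral.integral_const_mul,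
      ← intervalIntegral.integral_add ((inv_int T x μ).const_mul _) ((inv_int T x ν).const_mul _)]
    apply intervalIntegral.integral_mono_on hT.le (inv_int T x _)
      (((inv_int T x μ).const_mul _).add ((inv_int T x ν).const_mul _))
    intro t _
    simp only [FunLike.coe_add, FunLike.coe_smul, Pi.add_apply, Pi.smul_apply,
      smul_eq_mul]
    nlinarith [mul_nonneg (mul_nonneg h0.le (sub_nonneg.2 h1.le))
      (sq_nonneg (μ (Set.Ico 0 t) - ν (Set.Ico 0 t)))]
  rw [hC, hC, hC, hL, hQ]
  rw [hD] at hpos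
  have hI' := mul_le_mul_of_nonneg_left hI hφ
  have hP := mul_pos (mul_pos h0 (sub_pos.2 h1)) hpos
  linarith
end

section
/- The measure μ* = A·δ₀ + (B e^{-γt} + C)·1_{[0,T]}(t) dt + D·δ_T satisfies the fuel constraint μ*(ℝ) = -x, and it solves the first-order optimality equation with constant Lagrange multiplier λ = 2κC + ι/γ: for every t ∈ [0,T], (ι/γ)(1 - e^{-γt}) + κρ ∫_{[0,T]} e^{-ρ|t-s|} dμ*(s) = 2κC + ι/γ. -/
open MeasureTheory

lemma sint_eq_of_sub (ν : SignedMeasure ℝ) (P N : Measure ℝ) [IsFiniteMeasure P]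
    [IsFiniteMeasure N] (h : ∀ s, MeasurableSet s → ν s = P.real s - N.real s)
    (f : ℝ → ℝ) (hf : Continuous f) (b : ℝ) (hb : ∀ x, ‖f x‖ ≤ b) :
    sint ν f = (∫ t, f t ∂P) - ∫ t, f t ∂N := by
  have hi : ∀ (m : Measure ℝ) [IsFiniteMeasure m], Integrable f m := fun m _ =>
    Integrable.of_bound hf.aestronglyMeasurable b (Filter.Eventually.of_forall hb)
  have key : ν.toJordanDecomposition.posPart + N = ν.toJordanDecomposition.negPart + P := by
    ext s hs
    have h1 := h s hs
    have h2 : ν s = ν.toJordanDecomposition.posPart.real s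
        - ν.toJordanDecomposition.negPart.real s := by
      conv_lhs => rw [← ν.toSignedMeasure_toJordanDecomposition]
      rw [JordanDecomposition.toSignedMeasure, sub_apply,
        Measure.toSignedMeasure_apply_measurable hs, Measure.toSignedMeasure_apply_measurable hs]
    rw [← ENNReal.toReal_eq_toReal_iff' (measure_ne_top _ _) (measure_ne_top _ _)]
    change (ν.toJordanDecomposition.posPart + N).real s
      = (ν.toJordanDecomposition.negPart + P).real s
    rw [measureReal_add_apply, measureReal_add_apply]
    linarith
  have h3 : ∫ t, f t ∂(ν.toJordanDecomposition.posPart + N)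
      = ∫ t, f t ∂(ν.toJordanDecomposition.negPart + P) := by rw [key]
  rw [integral_add_measure (hi _) (hi _), integral_add_measure (hi _) (hi _)] at h3
  unfold sint
  linarith

noncomputable def pM (T a d : ℝ) (g : ℝ → ℝ) : Measure ℝ :=
  ENNReal.ofReal a • Measure.dirac 0
    + (volume.restrict (Set.Icc 0 T)).withDensity (fun t => ENNReal.ofReal (g t))
    + ENNReal.ofReal d • Measure.dirac T

lemma wd_finite (T : ℝ) (g : ℝ → ℝ) (hg : Continuous g) :
    IsFiniteMeasure ((volume.restrict (Set.Icc 0 T)).withDensity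
      (fun t => ENNReal.ofReal (g t))) :=
  isFiniteMeasure_withDensity_ofReal (hg.continuousOn.integrableOn_compact isCompact_Icc).2

lemma pM_finite (T a d : ℝ) (g : ℝ → ℝ) (hg : Continuous g) : IsFiniteMeasure (pM T a d g) := by
  have := wd_finite T g hg
  have h1 := Measure.smul_finite (Measure.dirac (0:ℝ)) (c := ENNReal.ofReal a) (by simp)
  have h2 := Measure.smul_finite (Measure.dirac T) (c := ENNReal.ofReal d) (by simp)
  unfold pM
  infer_instance

lemma pM_integral (T a d : ℝ) (g : ℝ → ℝ) (hg : Continuous g)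
    (f : ℝ → ℝ) (hf : Measurable f) (b : ℝ) (hb : ∀ x, ‖f x‖ ≤ b) :
    ∫ t, f t ∂(pM T a d g) =
      max a 0 * f 0 + (∫ t in Set.Icc 0 T, max (g t) 0 * f t) + max d 0 * f T := by
  have := wd_finite T g hg
  have h1 := Measure.smul_finite (Measure.dirac (0:ℝ)) (c := ENNReal.ofReal a) (by simp)
  have h2 := Measure.smul_finite (Measure.dirac T) (c := ENNReal.ofReal d) (by simp)
  have hi : ∀ (m : Measure ℝ) [IsFiniteMeasure m], Integrable f m := fun m _ =>
    Integrable.of_bound hf.aestronglyMeasurable b (Filter.Eventually.of_forall hb)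
  unfold pM
  rw [integral_add_measure (hi _) (hi _), integral_add_measure (hi _) (hi _),
    integral_smul_measure, integral_smul_measure, integral_dirac, integral_dirac,
    integral_withDensity_eq_integral_toReal_smul (by fun_prop)
      (Filter.Eventually.of_forall fun x => by simp)]
  simp [ENNReal.toReal_ofReal']

lemma pM_diff (T a d : ℝ) (g : ℝ → ℝ) (hg : Continuous g)
    (f : ℝ → ℝ) (hf : Measurable f) (b : ℝ) (hb : ∀ x, ‖f x‖ ≤ b) :
    (∫ t, f t ∂(pM T a d g)) - ∫ t, f t ∂(pM T (-a) (-d) (fun t => - g t)) =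
      a * f 0 + (∫ t in Set.Icc 0 T, g t * f t) + d * f T := by
  rw [pM_integral T a d g hg f hf b hb, pM_integral T (-a) (-d) (fun t => - g t) hg.neg f hf b hb]
  have hI : ∀ h : ℝ → ℝ, Continuous h → IntegrableOn (fun t => h t * f t) (Set.Icc 0 T) := by
    intro h hh
    exact Integrable.mul_bdd (c := b) (hh.continuousOn.integrableOn_compact isCompact_Icc)
      hf.aestronglyMeasurable (Filter.Eventually.of_forall hb)
  have e : ∫ t in Set.Icc 0 T, g t * f t = (∫ t in Set.Icc 0 T, max (g t) 0 * f t)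
      - ∫ t in Set.Icc 0 T, max (- g t) 0 * f t := by
    rw [← integral_sub (hI _ (by fun_prop)) (hI _ (by fun_prop))]
    congr 1
    ext t
    rw [← sub_mul]
    congr 1
    exact (max_zero_sub_eq_self _).symm
  have ea := max_zero_sub_eq_self a
  have ed := max_zero_sub_eq_self d
  rw [e]
  linear_combination f 0 * ea + f T * ed

lemma sint_formula (T a d : ℝ) (g : ℝ → ℝ) (hg : Continuous g) (ν : SignedMeasure ℝ)
    (h : ∀ s : Set ℝ, MeasurableSet s → ν s =
      s.indicator (fun _ => a) (0:ℝ) + (∫ t in s ∩ Set.Icc 0 T, g t)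
        + s.indicator (fun _ => d) T)
    (f : ℝ → ℝ) (hf : Continuous f) (b : ℝ) (hb : ∀ x, ‖f x‖ ≤ b) :
    sint ν f = a * f 0 + (∫ t in Set.Icc 0 T, g t * f t) + d * f T := by
  have := pM_finite T a d g hg
  have := pM_finite T (-a) (-d) (fun t => - g t) hg.neg
  rw [sint_eq_of_sub ν (pM T a d g) (pM T (-a) (-d) (fun t => - g t)) ?_ f hf b hb,
    pM_diff T a d g hg f hf.measurable b hb]
  intro s hs
  have := pM_diff T a d g hg (s.indicator 1) (measurable_one.indicator hs) 1 (by
    intro x; by_cases hx : x ∈ s <;> simp [hx])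
  rw [integral_indicator_one hs, integral_indicator_one hs] at this
  rw [this, h s hs]
  have e : (fun t => g t * s.indicator 1 t) = s.indicator g := by
    ext t; by_cases hx : t ∈ s <;> simp [hx]
  rw [e, integral_indicator hs, Measure.restrict_restrict hs]
  congr 1
  · congr 1
    by_cases hx : (0:ℝ) ∈ s <;> simp [hx]
  · by_cases hx : T ∈ s <;> simp [hx]

/-- The measure `μ* = A·δ₀ + (B e^{-γt} + C)·1_{[0,T]}(t) dt + D·δ_T` has total
mass `-x` (fuel constraint) and solves the first-order optimality equation with
Lagrange multiplier `λ = 2κC + ι/γ`. -/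
theorem stmt_5 (T x ι γ κ ρ : ℝ)
    (hT : 0 < T) (hγ : 0 < γ) (hκ : 0 < κ) (hρ : 0 < ρ)
    (A B C D : ℝ)
    (hB : B = ι * (ρ^2 - γ^2) / (2 * κ * ρ^2 * γ))
    (hA : A = (1 / (2 + T * ρ)) *
      ((ι / (2 * κ * ρ^2 * γ)) *
        ((ρ + γ) * (1 + T * ρ - ((ρ - γ) / γ) * (1 - Real.exp (-γ * T)))
          - (ρ - γ) * Real.exp (-γ * T)) - x))
    (hC : C = ρ * A - ι * (ρ + γ) / (2 * κ * ρ * γ))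
    (hD : D = A - (ι / (2 * κ * ρ^2 * γ)) *
      ((ρ + γ) - (ρ - γ) * Real.exp (-γ * T)))
    (μstar : SignedMeasure ℝ)
    (hsupp : ∀ s : Set ℝ, s ∩ Set.Icc 0 T = ∅ → μstar s = 0)
    (hμstar : ∀ s : Set ℝ, MeasurableSet s → μstar s =
      s.indicator (fun _ => A) (0:ℝ)
        + (∫ t in s ∩ Set.Icc 0 T, (B * Real.exp (-γ * t) + C))
        + s.indicator (fun _ => D) T) :
    μstar Set.univ = -x ∧
    (∀ t ∈ Set.Icc (0:ℝ) T,
      (ι / γ) * (1 - Real.exp (-γ * t))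
        + κ * ρ * sint μstar (fun s => Real.exp (-ρ * |t - s|))
        = 2 * κ * C + ι / γ) := by
  have h2T : (2 + T * ρ) ≠ 0 := by positivity
  obtain ⟨k, hk⟩ : ∃ k, k = ι / (2 * κ * ρ^2 * γ) := ⟨_, rfl⟩
  have hι : ι = k * (2 * κ * ρ^2 * γ) := by rw [hk]; field_simp
  have hB' : B = k * (ρ + γ) * (ρ - γ) := by rw [hB, hk]; field_simp; ring
  have hC' : C = ρ * (A - k * (ρ + γ)) := by rw [hC, hk]; field_simp
  rw [← hk] at hD hA
  have hA' : (2 + T * ρ) * A = k *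
        ((ρ + γ) * (1 + T * ρ - ((ρ - γ) / γ) * (1 - Real.exp (-γ * T)))
          - (ρ - γ) * Real.exp (-γ * T)) - x := by
    rw [hA]; field_simp
  have hg : Continuous (fun t => B * Real.exp (-γ * t) + C) := by fun_prop
  constructor
  · rw [hμstar _ MeasurableSet.univ]
    simp only [Set.univ_inter, Set.indicator_univ]
    rw [integral_Icc_eq_integral_Ioc, ← intervalIntegral.integral_of_le hT.le,
      intervalIntegral.integral_eq_sub_of_hasDerivAt
        (f := fun t => -(B / γ) * Real.exp (-γ * t) + C * t)
        (fun t _ => by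
          have h1 := (((hasDerivAt_id t).const_mul (-γ)).exp.const_mul (-(B / γ))).add
            ((hasDerivAt_id t).const_mul C)
          refine HasDerivAt.congr_deriv h1 ?_
          simp only [id_eq]
          field_simp)
        (hg.intervalIntegrable _ _)]
    simp only [mul_zero, Real.exp_zero]
    rw [hD, hC', hB']
    linear_combination hA'
  · intro t ht
    have hf : Continuous (fun s => Real.exp (-ρ * |t - s|)) := by fun_prop
    rw [sint_formula T A D _ hg μstar hμstar _ hf 1 (by
      intro s
      rw [Real.norm_eq_abs, abs_of_pos (Real.exp_pos _), Real.exp_le_one_iff]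
      nlinarith [abs_nonneg (t - s)])]
    have hgf : Continuous
        (fun s => (B * Real.exp (-γ * s) + C) * Real.exp (-ρ * |t - s|)) := hg.mul hf
    rw [integral_Icc_eq_integral_Ioc, ← intervalIntegral.integral_of_le hT.le,
      ← intervalIntegral.integral_add_adjacent_intervals
        (hgf.intervalIntegrable 0 t) (hgf.intervalIntegrable t T)]
    have e1 : ∫ s in (0:ℝ)..t, (B * Real.exp (-γ * s) + C) * Real.exp (-ρ * |t - s|)
        = ∫ s in (0:ℝ)..t, (B * Real.exp (-γ * s) + C) * Real.exp (-ρ * (t - s)) := by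
      apply intervalIntegral.integral_congr
      intro s hs
      rw [Set.uIcc_of_le ht.1] at hs
      simp only [abs_of_nonneg (sub_nonneg.2 hs.2)]
    have e2 : ∫ s in t..T, (B * Real.exp (-γ * s) + C) * Real.exp (-ρ * |t - s|)
        = ∫ s in t..T, (B * Real.exp (-γ * s) + C) * Real.exp (-ρ * (s - t)) := by
      apply intervalIntegral.integral_congr
      intro s hs
      rw [Set.uIcc_of_le ht.2] at hs
      simp only [abs_of_nonpos (sub_nonpos.2 hs.1), neg_sub]
    have hc1 : Continuous
        (fun s => (B * Real.exp (-γ * s) + C) * Real.exp (-ρ * (t - s))) := by fun_prop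
    have hc2 : Continuous
        (fun s => (B * Real.exp (-γ * s) + C) * Real.exp (-ρ * (s - t))) := by fun_prop
    have d0 : ∀ s, HasDerivAt (fun s => Real.exp (-γ * s)) (-γ * Real.exp (-γ * s)) s := by
      intro s
      have h1 := ((hasDerivAt_id s).const_mul (-γ)).exp
      refine HasDerivAt.congr_deriv h1 ?_
      simp only [id_eq]; ring
    have d1 : ∀ s, HasDerivAt (fun s => Real.exp (-ρ * (t - s)))
        (ρ * Real.exp (-ρ * (t - s))) s := by
      intro s
      have h1 := (((hasDerivAt_id s).const_sub t).const_mul (-ρ)).exp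
      refine HasDerivAt.congr_deriv h1 ?_
      simp only [id_eq]; ring
    have d2 : ∀ s, HasDerivAt (fun s => Real.exp (-ρ * (s - t)))
        (-ρ * Real.exp (-ρ * (s - t))) s := by
      intro s
      have h1 := (((hasDerivAt_id s).sub_const t).const_mul (-ρ)).exp
      refine HasDerivAt.congr_deriv h1 ?_
      simp only [id_eq]; ring
    rw [e1, e2, intervalIntegral.integral_eq_sub_of_hasDerivAt
        (f := fun s => (k * (ρ + γ) * Real.exp (-γ * s) + (A - k * (ρ + γ)))
          * Real.exp (-ρ * (t - s)))
        (fun s _ => by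
          have h1 := (((d0 s).const_mul (k * (ρ + γ))).add_const (A - k * (ρ + γ))).mul (d1 s)
          refine HasDerivAt.congr_deriv h1 ?_
          rw [hB', hC']; ring)
        (hc1.intervalIntegrable _ _),
      intervalIntegral.integral_eq_sub_of_hasDerivAt
        (f := fun s => -((k * (ρ - γ) * Real.exp (-γ * s) + (A - k * (ρ + γ)))
          * Real.exp (-ρ * (s - t))))
        (fun s _ => by
          have h1 := ((((d0 s).const_mul (k * (ρ - γ))).add_const
            (A - k * (ρ + γ))).mul (d2 s)).neg
          refine HasDerivAt.congr_deriv h1 ?_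
          rw [hB', hC']; ring)
        (hc2.intervalIntegrable _ _)]
    have a1 : |t - 0| = t - 0 := abs_of_nonneg (by linarith [ht.1])
    have a2 : |t - T| = T - t := by rw [abs_of_nonpos (by linarith [ht.2])]; ring
    have hιγ : ι / γ = 2 * κ * ρ^2 * k := by rw [hι]; field_simp
    simp only [a1, a2, sub_self, mul_zero, Real.exp_zero]
    rw [hιγ, hD, hC']
    ring
end

section
/- For every t ∈ [0,T] the denominator 1 - ζ e^{2β(T-t)} is nonzero; the function v₂ is continuously differentiable and bounded on [0,T], satisfies the Riccati equation v₂'(t) + v₂(t)²/κ - φ = 0 for all t ∈ [0,T], and meets the terminal condition v₂(T) = -ϱ. -/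
/-- Properties of the Riccati solution `v₂`: on `[0,T]` the denominator
`1 - ζ e^{2β(T-t)}` never vanishes, `v₂` is continuously differentiable and
bounded, satisfies the Riccati equation `v₂' + v₂²/κ - φ = 0`, and meets the
terminal condition `v₂(T) = -ϱ`. -/
theorem stmt_7 (T κ φ ϱ : ℝ)
    (hT : 0 < T) (hκ : 0 < κ) (hφ : 0 < φ) (hϱ : 0 < ϱ)
    (hne : ϱ ≠ Real.sqrt (κ * φ))
    (ζ β : ℝ)
    (hζ : ζ = (ϱ + Real.sqrt (κ * φ)) / (ϱ - Real.sqrt (κ * φ)))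
    (hβ : β = Real.sqrt (φ / κ))
    (v₂ : ℝ → ℝ)
    (hv₂ : ∀ t : ℝ, v₂ t = Real.sqrt (κ * φ) *
      (1 + ζ * Real.exp (2 * β * (T - t))) /
      (1 - ζ * Real.exp (2 * β * (T - t)))) :
    (∀ t ∈ Set.Icc (0:ℝ) T, 1 - ζ * Real.exp (2 * β * (T - t)) ≠ 0) ∧
    ContDiffOn ℝ 1 v₂ (Set.Icc 0 T) ∧
    (∃ M : ℝ, ∀ t ∈ Set.Icc (0:ℝ) T, |v₂ t| ≤ M) ∧
    (∀ t ∈ Set.Icc (0:ℝ) T, HasDerivAt v₂ (φ - (v₂ t)^2 / κ) t) ∧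
    v₂ T = -ϱ := by
  have hs0 : 0 < Real.sqrt (κ * φ) := Real.sqrt_pos.mpr (mul_pos hκ hφ)
  have hs2 : Real.sqrt (κ * φ) ^ 2 = κ * φ := Real.sq_sqrt (mul_pos hκ hφ).le
  have hβ0 : 0 ≤ β := hβ ▸ Real.sqrt_nonneg _
  have hsβ : Real.sqrt (κ * φ) * β = φ := by
    rw [hβ, ← Real.sqrt_mul (mul_pos hκ hφ).le]
    have : κ * φ * (φ / κ) = φ ^ 2 := by field_simp
    rw [this, Real.sqrt_sq hφ.le]
  generalize Real.sqrt (κ * φ) = s at *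
  have hd : ϱ - s ≠ 0 := sub_ne_zero.mpr hne
  have hden : ∀ t ∈ Set.Icc (0:ℝ) T, 1 - ζ * Real.exp (2 * β * (T - t)) ≠ 0 := by
    intro t ht h
    have hE : 1 ≤ Real.exp (2 * β * (T - t)) :=
      Real.one_le_exp (mul_nonneg (by positivity) (by linarith [ht.2]))
    have h2 : (ϱ + s) * Real.exp (2 * β * (T - t)) = ϱ - s := by
      rw [hζ] at h
      field_simp at h
      linarith
    nlinarith
  have hvf : v₂ = fun t => s * (1 + ζ * Real.exp (2 * β * (T - t))) /
      (1 - ζ * Real.exp (2 * β * (T - t))) := funext hv₂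
  have hC : ContDiffOn ℝ 1 v₂ (Set.Icc 0 T) := by
    rw [hvf]
    apply ContDiffOn.div _ _ hden
    · exact ContDiff.contDiffOn (by fun_prop)
    · exact ContDiff.contDiffOn (by fun_prop)
  refine ⟨hden, hC, ?_, ?_, ?_⟩
  · obtain ⟨M, hM⟩ := isCompact_Icc.exists_bound_of_continuousOn hC.continuousOn
    exact ⟨M, fun t ht => by simpa using hM t ht⟩
  · intro t ht
    have hx := hden t ht
    have h1 : HasDerivAt (fun t => ζ * Real.exp (2 * β * (T - t)))
        (ζ * (Real.exp (2 * β * (T - t)) * (2 * β * (-1)))) t :=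
      ((((hasDerivAt_id t).const_sub T).const_mul (2 * β)).exp).const_mul ζ
    have h2 := ((h1.const_add 1).const_mul s).div (h1.const_sub 1) hx
    rw [hv₂ t]
    have h3 := h2.congr_of_eventuallyEq (f₁ := v₂) (Filter.Eventually.of_forall hv₂)
    refine h3.congr_deriv ?_
    generalize Real.exp (2 * β * (T - t)) = E at *
    rw [div_pow, mul_pow, hs2, eq_sub_iff_add_eq]
    field_simp
    linear_combination (-4 * ζ * E) * hsβ
  · rw [hv₂ T, hζ]
    have hs' : s ≠ 0 := hs0.ne'
    have h4 : 1 - (ϱ + s) / (ϱ - s) = -(2 * s) / (ϱ - s) := by field_simp; ring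
    have h5 : 1 + (ϱ + s) / (ϱ - s) = (2 * ϱ) / (ϱ - s) := by field_simp; ring
    simp only [sub_self, mul_zero, Real.exp_zero, mul_one]
    rw [h4, h5]
    field_simp
end

section
/- The function w(t,ι) = (1/(4κ)) ∫ₜᵀ F(s)² ( ι² e^{-2γ(s-t)} + (σ²/(2γ))(1 - e^{-2γ(s-t)}) ) ds is a classical solution on [0,T] × ℝ of the partial differential equation ∂ₜw(t,ι) - γι ∂_ι w(t,ι) + (σ²/2) ∂²_{ιι} w(t,ι) + (1/(4κ)) ι² F(t)² = 0, with terminal condition w(T,ι) = 0 for all ι ∈ ℝ. -/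
theorem aux_ii {f : ℝ → ℝ} {c a b : ℝ} (hf : ContinuousOn f (Set.Iio c)) (ha : a < c)
    (hb : b < c) : IntervalIntegrable f MeasureTheory.volume a b := by
  apply ContinuousOn.intervalIntegrable
  apply hf.mono
  intro x hx
  exact lt_of_le_of_lt hx.2 (max_lt ha hb)

theorem aux_deriv {f : ℝ → ℝ} {c a : ℝ} (hf : ContinuousOn f (Set.Iio c)) (ha : a < c)
    {t : ℝ} (ht : t < c) : HasDerivAt (fun x => ∫ s in a..x, f s) (f t) t := by
  apply intervalIntegral.integral_hasDerivAt_right (aux_ii hf ha ht)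
  · exact hf.stronglyMeasurableAtFilter isOpen_Iio t ht
  · exact hf.continuousAt (Iio_mem_nhds ht)

theorem aux_cont {f : ℝ → ℝ} {c a : ℝ} (hf : ContinuousOn f (Set.Iio c)) (ha : a < c) :
    ContinuousOn (fun x => ∫ s in a..x, f s) (Set.Iio c) :=
  fun _ ht => (aux_deriv hf ha ht).continuousAt.continuousWithinAt

theorem aux_den (T r ϱ β : ℝ) (hr : 0 < r) (hϱ : 0 < ϱ) (hne : ϱ ≠ r) (hβ : 0 < β) :
    ∃ c, T < c ∧ ∀ t < c, 1 - ((ϱ + r) / (ϱ - r)) * Real.exp (2 * β * (T - t)) ≠ 0 := by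
  rcases lt_or_gt_of_ne hne with h | h
  · refine ⟨T + 1, by linarith, fun t _ => ?_⟩
    have h1 : (ϱ + r) / (ϱ - r) < 0 := div_neg_of_pos_of_neg (by linarith) (by linarith)
    have := mul_neg_of_neg_of_pos h1 (Real.exp_pos (2 * β * (T - t)))
    linarith
  · have h1 : 1 < (ϱ + r) / (ϱ - r) := by
      rw [one_lt_div (by linarith)]; linarith
    set z := (ϱ + r) / (ϱ - r)
    have hl := Real.log_pos h1
    refine ⟨T + Real.log z / (2 * β), by have : 0 < Real.log z / (2 * β) := by positivity
                                         linarith, fun t ht => ?_⟩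
    have h2 : t - T < Real.log z / (2 * β) := by linarith
    rw [lt_div_iff₀ (by positivity)] at h2
    have h3 : 0 < Real.log z + 2 * β * (T - t) := by linarith
    have h4 := Real.one_lt_exp_iff.2 h3
    rw [Real.exp_add, Real.exp_log (by linarith)] at h4
    linarith

/-- The function `w(t,ι) = (1/(4κ)) ∫ₜᵀ F(s)² (ι² e^{-2γ(s-t)} + (σ²/(2γ))(1 - e^{-2γ(s-t)})) ds`
is a classical solution on `[0,T] × ℝ` of
`∂ₜw - γι ∂_ι w + (σ²/2) ∂²_{ιι} w + (1/(4κ)) ι² F(t)² = 0`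
with terminal condition `w(T,ι) = 0`. -/
theorem stmt_9 (T κ φ ϱ γ σ : ℝ)
    (hT : 0 < T) (hκ : 0 < κ) (hφ : 0 < φ) (hϱ : 0 < ϱ) (hγ : 0 < γ)
    (hσ : 0 < σ) (hne : ϱ ≠ Real.sqrt (κ * φ))
    (ζ β : ℝ)
    (hζ : ζ = (ϱ + Real.sqrt (κ * φ)) / (ϱ - Real.sqrt (κ * φ)))
    (hβ : β = Real.sqrt (φ / κ))
    (v₂ : ℝ → ℝ)
    (hv₂ : ∀ t : ℝ, v₂ t = Real.sqrt (κ * φ) *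
      (1 + ζ * Real.exp (2 * β * (T - t))) /
      (1 - ζ * Real.exp (2 * β * (T - t))))
    (F : ℝ → ℝ)
    (hF : ∀ t : ℝ, F t =
      ∫ s in t..T, Real.exp (-γ * (s - t) + (1 / κ) * ∫ u in t..s, v₂ u))
    (w : ℝ → ℝ → ℝ)
    (hw : ∀ t ι : ℝ, w t ι = (1 / (4 * κ)) *
      ∫ s in t..T, (F s)^2 *
        (ι^2 * Real.exp (-2 * γ * (s - t))
          + (σ^2 / (2 * γ)) * (1 - Real.exp (-2 * γ * (s - t))))) :
    (∀ ι : ℝ, w T ι = 0) ∧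
    (∀ t ∈ Set.Icc (0:ℝ) T, ∀ ι : ℝ,
      ∃ (wt wιι : ℝ) (wι : ℝ → ℝ),
        HasDerivAt (fun τ => w τ ι) wt t ∧
        (∀ j : ℝ, HasDerivAt (fun j' => w t j') (wι j) j) ∧
        ContinuousOn wι Set.univ ∧
        HasDerivAt wι wιι ι ∧
        wt - γ * ι * wι ι + (σ^2 / 2) * wιι
          + (1 / (4 * κ)) * ι^2 * (F t)^2 = 0) := by
  refine ⟨fun ι => by rw [hw]; simp, ?_⟩
  obtain ⟨c, hTc, hc⟩ := aux_den T (Real.sqrt (κ * φ)) ϱ β (by positivity) hϱ hne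
    (by rw [hβ]; positivity)
  rw [← hζ] at hc
  have hv : ContinuousOn v₂ (Set.Iio c) := by
    rw [funext hv₂]
    exact ContinuousOn.div (by fun_prop) (by fun_prop) hc
  have hG := aux_cont hv hTc
  set G : ℝ → ℝ := fun x => ∫ s in T..x, v₂ s with hGdef
  have hE : ContinuousOn (fun s => Real.exp (-γ * s + (1 / κ) * G s)) (Set.Iio c) := by
    fun_prop
  have hH := aux_cont hE hTc
  have hFeq : ∀ t < c, F t = - (Real.exp (γ * t - (1 / κ) * G t) *
      ∫ s in T..t, Real.exp (-γ * s + (1 / κ) * G s)) := by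
    intro t ht
    rw [hF, intervalIntegral.integral_symm T t, ← intervalIntegral.integral_const_mul]
    congr 1
    apply intervalIntegral.integral_congr
    intro s hs
    have hsc : s < c := lt_of_le_of_lt hs.2 (max_lt hTc ht)
    have h1 : ∫ u in t..s, v₂ u = G s - G t :=
      (intervalIntegral.integral_interval_sub_left (aux_ii hv hTc hsc) (aux_ii hv hTc ht)).symm
    simp only
    rw [h1, ← Real.exp_add]
    congr 1
    ring
  have hFc : ContinuousOn F (Set.Iio c) := by
    refine ContinuousOn.congr ?_ hFeq
    exact (ContinuousOn.mul (by fun_prop) hH).neg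
  have hAc : ContinuousOn (fun s => (F s)^2 * Real.exp (-2 * γ * s)) (Set.Iio c) := by fun_prop
  have hBc : ContinuousOn (fun s => (F s)^2) (Set.Iio c) := by fun_prop
  have hA := fun t ht => aux_deriv (t := t) hAc hTc ht
  have hB := fun t ht => aux_deriv (t := t) hBc hTc ht
  set A : ℝ → ℝ := fun x => ∫ s in T..x, (F s)^2 * Real.exp (-2 * γ * s) with hAdef
  set B : ℝ → ℝ := fun x => ∫ s in T..x, (F s)^2 with hBdef
  have hweq : ∀ τ < c, ∀ ι, w τ ι = -(1 / (4 * κ)) * ((ι^2 - σ^2 / (2 * γ)) *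
      (Real.exp (2 * γ * τ) * A τ) + σ^2 / (2 * γ) * B τ) := by
    intro τ hτ ι
    rw [hw, intervalIntegral.integral_symm T τ, hAdef, hBdef]
    simp only
    rw [← mul_assoc, ← intervalIntegral.integral_const_mul, ← intervalIntegral.integral_const_mul,
      ← intervalIntegral.integral_add ((aux_ii hAc hTc hτ).const_mul _)
        ((aux_ii hBc hTc hτ).const_mul _), mul_neg, neg_mul (1 / (4 * κ))]
    congr 2
    apply intervalIntegral.integral_congr
    intro s _
    have h1 : Real.exp (-2 * γ * (s - τ)) = Real.exp (2 * γ * τ) * Real.exp (-2 * γ * s) := by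
      rw [← Real.exp_add]; congr 1; ring
    simp only
    rw [h1]
    ring
  intro t ht ι
  have htc : t < c := lt_of_le_of_lt ht.2 hTc
  refine ⟨-(1 / (4 * κ)) * ((ι^2 - σ^2 / (2 * γ)) *
      (Real.exp (2 * γ * t) * (2 * γ) * A t +
        Real.exp (2 * γ * t) * ((F t)^2 * Real.exp (-2 * γ * t))) + σ^2 / (2 * γ) * (F t)^2),
    -(1 / (4 * κ)) * (2 * (Real.exp (2 * γ * t) * A t)),
    fun j => -(1 / (4 * κ)) * (2 * (Real.exp (2 * γ * t) * A t)) * j, ?_, ?_, by fun_prop, ?_, ?_⟩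
  · have hexp : HasDerivAt (fun τ => Real.exp (2 * γ * τ)) (Real.exp (2 * γ * t) * (2 * γ)) t := by
      simpa using ((hasDerivAt_id t).const_mul (2 * γ)).exp
    have := ((((hexp.mul (hA t htc)).const_mul (ι^2 - σ^2 / (2 * γ))).add
      ((hB t htc).const_mul (σ^2 / (2 * γ)))).const_mul (-(1 / (4 * κ))))
    refine this.congr_of_eventuallyEq ?_
    filter_upwards [Iio_mem_nhds htc] with τ hτ
    exact hweq τ hτ ι
  · intro j
    rw [funext (hweq t htc)]
    have := (((((hasDerivAt_id j).pow 2).sub_const (σ^2 / (2 * γ))).mul_const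
      (Real.exp (2 * γ * t) * A t)).add_const (σ^2 / (2 * γ) * B t)).const_mul (-(1 / (4 * κ)))
    refine this.congr_deriv ?_
    simp
    ring
  · simpa using (hasDerivAt_id ι).const_mul (-(1 / (4 * κ)) * (2 * (Real.exp (2 * γ * t) * A t)))
  · have h1 : Real.exp (2 * γ * t) * ((F t)^2 * Real.exp (-2 * γ * t)) = (F t)^2 := by
      rw [mul_left_comm, ← Real.exp_add]
      ring_nf
      simp
    rw [h1]
    field_simp
    ring
end

section
/- The function V(t,ι,c,x,p) = c + x p + w(t,ι) + x ι F(t) + x² v₂(t) is a classical solution on [0,T] × ℝ⁴ of the Hamilton–Jacobi–Bellman equation 0 = ∂ₜV - γι ∂_ι V + (σ²/2) ∂²_{ιι} V + ι ∂_p V + ((σᴾ)²/2) ∂²_{pp} V - φ x² + sup_{r ∈ ℝ} { r(p - κ r) ∂_c V - r ∂_x V }, with terminal condition V(T,ι,c,x,p) = c + x(p - ϱ x); moreover, for each (t,ι,c,x,p) the supremum over r is attained at r* = -(1/(2κ)) ( 2 v₂(t) x + ι F(t) ). This is the Hamilton–Jacobi–Bellman equation of the optimal liquidation problem with instantaneous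 market impact κ, risk aversion φ, terminal penalty ϱ, specialized to an Ornstein–Uhlenbeck signal. -/
theorem aux_int {b T t : ℝ} {g : ℝ → ℝ} (hg : ContinuousOn g (Set.Iio b)) (hT : T < b)
    (ht : t < b) : IntervalIntegrable g MeasureTheory.volume t T := by
  apply ContinuousOn.intervalIntegrable
  apply hg.mono
  intro s hs
  have := hs.2
  exact lt_of_le_of_lt this (max_lt ht hT)

theorem aux_deriv_s10 {b T t : ℝ} {g : ℝ → ℝ} (hg : ContinuousOn g (Set.Iio b)) (hT : T < b)
    (ht : t < b) : HasDerivAt (fun t => ∫ s in t..T, g s) (-g t) t :=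
  intervalIntegral.integral_hasDerivAt_left (aux_int hg hT ht)
    (hg.stronglyMeasurableAtFilter isOpen_Iio t ht) (hg.continuousAt (Iio_mem_nhds ht))

theorem aux_v (T κ φ ϱ : ℝ) (hκ : 0 < κ) (hφ : 0 < φ) (hϱ : 0 < ϱ)
    (hne : ϱ ≠ Real.sqrt (κ * φ)) (ζ β : ℝ)
    (hζ : ζ = (ϱ + Real.sqrt (κ * φ)) / (ϱ - Real.sqrt (κ * φ)))
    (hβ : β = Real.sqrt (φ / κ))
    (v₂ : ℝ → ℝ)
    (hv₂ : ∀ t : ℝ, v₂ t = Real.sqrt (κ * φ) *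
      (1 + ζ * Real.exp (2 * β * (T - t))) /
      (1 - ζ * Real.exp (2 * β * (T - t)))) :
    v₂ T = -ϱ ∧ ∃ b, T < b ∧ ∀ t < b, HasDerivAt v₂ (φ - v₂ t ^ 2 / κ) t := by
  have hm : 0 < Real.sqrt (κ * φ) := Real.sqrt_pos.2 (by positivity)
  have hm2 : Real.sqrt (κ * φ) ^ 2 = κ * φ := Real.sq_sqrt (by positivity)
  have hβ0 : 0 < β := by rw [hβ]; exact Real.sqrt_pos.2 (by positivity)
  have hβm : κ * β = Real.sqrt (κ * φ) := by
    have h1 : κ * φ = κ ^ 2 * (φ / κ) := by field_simp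
    rw [hβ, h1, Real.sqrt_mul (by positivity), Real.sqrt_sq hκ.le]
  set m := Real.sqrt (κ * φ) with hmdef
  have hd : ϱ - m ≠ 0 := sub_ne_zero.2 hne
  have hz1 : 1 - ζ = -2 * m / (ϱ - m) := by rw [hζ]; field_simp; ring
  have hz2 : 1 + ζ = 2 * ϱ / (ϱ - m) := by rw [hζ]; field_simp; ring
  have hden : ∀ t ≤ T, 1 - ζ * Real.exp (2 * β * (T - t)) ≠ 0 := by
    intro t ht
    have he : 1 ≤ Real.exp (2 * β * (T - t)) := by
      apply Real.one_le_exp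
      have : 0 ≤ T - t := by linarith
      positivity
    rcases lt_or_gt_of_ne hd with h | h
    · have : ζ < 0 := by rw [hζ]; exact div_neg_of_pos_of_neg (by positivity) h
      nlinarith
    · have : 1 < ζ := by rw [hζ, lt_div_iff₀ h]; linarith
      nlinarith
  refine ⟨?_, ?_⟩
  · rw [hv₂, sub_self, mul_zero, Real.exp_zero, mul_one, hz1, hz2]
    field_simp
  have hcont : Continuous (fun t => 1 - ζ * Real.exp (2 * β * (T - t))) := by fun_prop
  have hU : ∀ᶠ t in nhds T, 1 - ζ * Real.exp (2 * β * (T - t)) ≠ 0 :=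
    hcont.continuousAt.eventually_ne (hden T le_rfl)
  obtain ⟨ε, hε, hball⟩ := Metric.eventually_nhds_iff.1 hU
  refine ⟨T + ε, by linarith, fun t ht => ?_⟩
  have hdt : 1 - ζ * Real.exp (2 * β * (T - t)) ≠ 0 := by
    rcases le_or_gt t T with h | h
    · exact hden t h
    · apply hball
      rw [Real.dist_eq, abs_of_pos (by linarith)]; linarith
  have hE : HasDerivAt (fun t => Real.exp (2 * β * (T - t)))
      (Real.exp (2 * β * (T - t)) * (2 * β * (-1))) t := by
    have := (((hasDerivAt_id t).const_sub T).const_mul (2 * β)).exp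
    simpa using this
  have hfun : v₂ = fun t => m * (1 + ζ * Real.exp (2 * β * (T - t))) /
      (1 - ζ * Real.exp (2 * β * (T - t))) := funext hv₂
  have := (((hE.const_mul ζ).const_add 1).const_mul m).div ((hE.const_mul ζ).const_sub 1) hdt
  rw [hfun]
  refine this.congr_deriv ?_
  simp only
  have hφm : φ = m ^ 2 / κ := by rw [hm2]; field_simp
  have hβe : β = m / κ := by rw [← hβm]; field_simp
  generalize Real.exp (2 * β * (T - t)) = E at hdt ⊢
  rw [hφm, hβe]
  field_simp
  ring

theorem aux_F (T κ γ b : ℝ) (hb : T < b) (v₂ : ℝ → ℝ) (hv : ContinuousOn v₂ (Set.Iio b))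
    (F : ℝ → ℝ)
    (hF : ∀ t : ℝ, F t =
      ∫ s in t..T, Real.exp (-γ * (s - t) + (1 / κ) * ∫ u in t..s, v₂ u)) :
    ∀ t < b, HasDerivAt F (γ * F t - v₂ t * F t / κ - 1) t := by
  let G : ℝ → ℝ := fun t => ∫ u in t..T, v₂ u
  have hG : ∀ t < b, HasDerivAt G (-v₂ t) t := fun t ht => aux_deriv_s10 hv hb ht
  let g : ℝ → ℝ := fun s => Real.exp (-γ * s - G s / κ)
  have hg : ContinuousOn g (Set.Iio b) := by
    intro s hs
    have h1 : ContinuousAt G s := (hG s hs).continuousAt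
    have : ContinuousAt g s := by fun_prop
    exact this.continuousWithinAt
  have key : ∀ t < b, F t = Real.exp (γ * t + G t / κ) * ∫ s in t..T, g s := by
    intro t ht
    rw [hF, ← intervalIntegral.integral_const_mul]
    apply intervalIntegral.integral_congr
    intro s hs
    have hs' : s < b := lt_of_le_of_lt hs.2 (max_lt ht hb)
    have h1 : ∫ u in t..s, v₂ u = G t - G s := by
      have := intervalIntegral.integral_add_adjacent_intervals (aux_int hv hs' ht)
        (aux_int hv hb hs')
      simp only [G]; linarith
    simp only [g]
    rw [h1, ← Real.exp_add]
    congr 1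
    ring
  intro t ht
  have h1 : HasDerivAt (fun t => Real.exp (γ * t + G t / κ))
      (Real.exp (γ * t + G t / κ) * (γ + -v₂ t / κ)) t := by
    have := (((hasDerivAt_id t).const_mul γ).add ((hG t ht).div_const κ)).exp
    simpa using this
  have h2 := h1.mul (aux_deriv_s10 hg hb ht)
  have hev : F =ᶠ[nhds t] fun t => Real.exp (γ * t + G t / κ) * ∫ s in t..T, g s := by
    filter_upwards [Iio_mem_nhds ht] with s hs using key s hs
  refine (h2.congr_of_eventuallyEq hev).congr_deriv ?_
  rw [key t ht]
  have h3 : Real.exp (γ * t + G t / κ) * g t = 1 := by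
    simp only [g]
    rw [← Real.exp_add, ← Real.exp_zero]; congr 1; ring
  linear_combination -h3

theorem aux_w (T κ γ σ b : ℝ) (hb : T < b) (hγ : 0 < γ)
    (F : ℝ → ℝ) (hFc : ContinuousOn F (Set.Iio b))
    (w : ℝ → ℝ → ℝ)
    (hw : ∀ t ι : ℝ, w t ι = (1 / (4 * κ)) *
      ∫ s in t..T, (F s)^2 *
        (ι^2 * Real.exp (-2 * γ * (s - t))
          + (σ^2 / (2 * γ)) * (1 - Real.exp (-2 * γ * (s - t))))) :
    ∃ a c : ℝ → ℝ, ∀ t < b, (∀ ι, w t ι = a t * ι ^ 2 + c t) ∧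
      HasDerivAt a (2 * γ * a t - F t ^ 2 / (4 * κ)) t ∧
      HasDerivAt c (- σ ^ 2 * a t) t := by
  let A : ℝ → ℝ := fun t => ∫ s in t..T, F s ^ 2 * Real.exp (-2 * γ * s)
  let B : ℝ → ℝ := fun t => ∫ s in t..T, F s ^ 2
  have hAc : ContinuousOn (fun s => F s ^ 2 * Real.exp (-2 * γ * s)) (Set.Iio b) := by fun_prop
  have hBc : ContinuousOn (fun s => F s ^ 2) (Set.Iio b) := by fun_prop
  refine ⟨fun t => 1 / (4 * κ) * (Real.exp (2 * γ * t) * A t),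
    fun t => 1 / (4 * κ) * (σ ^ 2 / (2 * γ) * (B t - Real.exp (2 * γ * t) * A t)), ?_⟩
  intro t ht
  have hA : HasDerivAt A _ t := aux_deriv_s10 hAc hb ht
  have hB : HasDerivAt B _ t := aux_deriv_s10 hBc hb ht
  have hE : HasDerivAt (fun t => Real.exp (2 * γ * t)) (Real.exp (2 * γ * t) * (2 * γ)) t := by
    have := ((hasDerivAt_id t).const_mul (2 * γ)).exp
    simpa using this
  have h3 : Real.exp (2 * γ * t) * Real.exp (-2 * γ * t) = 1 := by
    rw [← Real.exp_add, ← Real.exp_zero]; congr 1; ring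
  refine ⟨fun ι => ?_, ?_, ?_⟩
  · rw [hw]
    have : ∫ s in t..T, (F s)^2 *
        (ι^2 * Real.exp (-2 * γ * (s - t))
          + (σ^2 / (2 * γ)) * (1 - Real.exp (-2 * γ * (s - t))))
        = (ι ^ 2 - σ ^ 2 / (2 * γ)) * Real.exp (2 * γ * t) * A t + σ ^ 2 / (2 * γ) * B t := by
      simp only [A, B]
      rw [← intervalIntegral.integral_const_mul, ← intervalIntegral.integral_const_mul,
        ← intervalIntegral.integral_add ((aux_int hAc hb ht).const_mul _)
          ((aux_int hBc hb ht).const_mul _)]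
      apply intervalIntegral.integral_congr
      intro s _
      have : Real.exp (-2 * γ * (s - t)) = Real.exp (2 * γ * t) * Real.exp (-2 * γ * s) := by
        rw [← Real.exp_add]; congr 1; ring
      simp only
      rw [this]; ring
    rw [this]; ring
  · refine ((hE.mul hA).const_mul (1 / (4 * κ))).congr_deriv ?_
    linear_combination (-F t ^ 2 / (4 * κ)) * h3
  · refine (((hB.sub (hE.mul hA)).const_mul (σ ^ 2 / (2 * γ))).const_mul
      (1 / (4 * κ))).congr_deriv ?_
    have h4 : σ ^ 2 / (2 * γ) * (2 * γ) = σ ^ 2 := by field_simp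
    linear_combination (1 / (4 * κ) * (σ ^ 2 / (2 * γ)) * F t ^ 2) * h3
      - (1 / (4 * κ)) * (Real.exp (2 * γ * t) * A t) * h4

/-- The candidate value function `V(t,ι,c,x,p) = c + xp + w(t,ι) + xιF(t) + x²v₂(t)`
is a classical solution of the HJB equation
`0 = ∂ₜV - γι∂_ιV + (σ²/2)∂²_{ιι}V + ι∂ₚV + ((σᴾ)²/2)∂²_{pp}V - φx²
   + sup_r { r(p-κr)∂_cV - r∂_xV }`
with terminal condition `V(T,ι,c,x,p) = c + x(p - ϱx)`, and the supremum is
attained at `r* = -(1/(2κ))(2v₂(t)x + ιF(t))`. -/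
theorem stmt_10 (T κ φ ϱ γ σ σP : ℝ)
    (hT : 0 < T) (hκ : 0 < κ) (hφ : 0 < φ) (hϱ : 0 < ϱ) (hγ : 0 < γ)
    (hσ : 0 < σ) (hσP : 0 < σP) (hne : ϱ ≠ Real.sqrt (κ * φ))
    (ζ β : ℝ)
    (hζ : ζ = (ϱ + Real.sqrt (κ * φ)) / (ϱ - Real.sqrt (κ * φ)))
    (hβ : β = Real.sqrt (φ / κ))
    (v₂ : ℝ → ℝ)
    (hv₂ : ∀ t : ℝ, v₂ t = Real.sqrt (κ * φ) *
      (1 + ζ * Real.exp (2 * β * (T - t))) /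
      (1 - ζ * Real.exp (2 * β * (T - t))))
    (F : ℝ → ℝ)
    (hF : ∀ t : ℝ, F t =
      ∫ s in t..T, Real.exp (-γ * (s - t) + (1 / κ) * ∫ u in t..s, v₂ u))
    (w : ℝ → ℝ → ℝ)
    (hw : ∀ t ι : ℝ, w t ι = (1 / (4 * κ)) *
      ∫ s in t..T, (F s)^2 *
        (ι^2 * Real.exp (-2 * γ * (s - t))
          + (σ^2 / (2 * γ)) * (1 - Real.exp (-2 * γ * (s - t)))))
    (V : ℝ → ℝ → ℝ → ℝ → ℝ → ℝ)
    (hV : ∀ t ι c x p : ℝ,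
      V t ι c x p = c + x * p + w t ι + x * ι * F t + x^2 * v₂ t) :
    (∀ ι c x p : ℝ, V T ι c x p = c + x * (p - ϱ * x)) ∧
    (∀ t ∈ Set.Icc (0:ℝ) T, ∀ ι c x p : ℝ,
      ∃ (Vt Vιι Vpp Vc Vx : ℝ) (Vι Vp : ℝ → ℝ),
        HasDerivAt (fun τ => V τ ι c x p) Vt t ∧
        (∀ j : ℝ, HasDerivAt (fun j' => V t j' c x p) (Vι j) j) ∧
        HasDerivAt Vι Vιι ι ∧
        (∀ q : ℝ, HasDerivAt (fun q' => V t ι c x q') (Vp q) q) ∧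
        HasDerivAt Vp Vpp p ∧
        HasDerivAt (fun c' => V t ι c' x p) Vc c ∧
        HasDerivAt (fun x' => V t ι c x' p) Vx x ∧
        (let rstar := -(1 / (2 * κ)) * (2 * v₂ t * x + ι * F t);
          IsGreatest {y : ℝ | ∃ r : ℝ, y = r * (p - κ * r) * Vc - r * Vx}
            (rstar * (p - κ * rstar) * Vc - rstar * Vx) ∧
          0 = Vt - γ * ι * Vι ι + (σ^2 / 2) * Vιι + ι * Vp p
            + (σP^2 / 2) * Vpp - φ * x^2
            + (rstar * (p - κ * rstar) * Vc - rstar * Vx))) := by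
  obtain ⟨hvT, b, hb, hv⟩ := aux_v T κ φ ϱ hκ hφ hϱ hne ζ β hζ hβ v₂ hv₂
  have hvc : ContinuousOn v₂ (Set.Iio b) := fun s hs =>
    (hv s hs).continuousAt.continuousWithinAt
  have hFd := aux_F T κ γ b hb v₂ hvc F hF
  have hFc : ContinuousOn F (Set.Iio b) := fun s hs =>
    (hFd s hs).continuousAt.continuousWithinAt
  obtain ⟨a, e, hae⟩ := aux_w T κ γ σ b hb hγ F hFc w hw
  refine ⟨?_, ?_⟩
  · intro ι c x p
    rw [hV, hw, hF, hvT, intervalIntegral.integral_same, intervalIntegral.integral_same]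
    ring
  intro t ht ι c x p
  have htb : t < b := lt_of_le_of_lt ht.2 hb
  obtain ⟨hwt, ha, he⟩ := hae t htb
  refine ⟨(2 * γ * a t - F t ^ 2 / (4 * κ)) * ι ^ 2 + (- σ ^ 2 * a t)
      + x * ι * (γ * F t - v₂ t * F t / κ - 1) + x ^ 2 * (φ - v₂ t ^ 2 / κ),
    2 * a t, 0, 1, p + ι * F t + 2 * x * v₂ t,
    fun j => 2 * a t * j + x * F t, fun _ => x, ?_, ?_, ?_, ?_, ?_, ?_, ?_, ?_⟩
  · have h := (((((ha.mul_const (ι ^ 2)).add he).const_add (c + x * p)).add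
      ((hFd t htb).const_mul (x * ι))).add ((hv t htb).const_mul (x ^ 2)))
    refine (h.congr_of_eventuallyEq ?_).congr_deriv (by ring)
    filter_upwards [Iio_mem_nhds htb] with s hs
    rw [hV, (hae s hs).1]
    simp only [Pi.add_apply]
  · intro j
    have h : (fun j' => V t j' c x p) =
        fun j' => a t * j' ^ 2 + x * F t * j' + (c + x * p + e t + x ^ 2 * v₂ t) := by
      funext j'; rw [hV, hwt]; ring
    rw [h]
    refine (((((hasDerivAt_id j).pow 2).const_mul (a t)).add
      ((hasDerivAt_id j).const_mul (x * F t))).add_const _).congr_deriv ?_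
    simp; ring
  · refine (((hasDerivAt_id ι).const_mul (2 * a t)).add_const _).congr_deriv ?_
    ring
  · intro q
    have h : (fun q' => V t ι c x q') =
        fun q' => x * q' + (c + w t ι + x * ι * F t + x ^ 2 * v₂ t) := by
      funext j'; rw [hV]; ring
    rw [h]
    exact (((hasDerivAt_id q).const_mul x).add_const _).congr_deriv (by ring)
  · exact hasDerivAt_const _ _
  · have h : (fun c' => V t ι c' x p) =
        fun c' => c' + (x * p + w t ι + x * ι * F t + x ^ 2 * v₂ t) := by
      funext j'; rw [hV]; ring
    rw [h]
    exact (hasDerivAt_id c).add_const _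
  · have h : (fun x' => V t ι c x' p) =
        fun x' => v₂ t * x' ^ 2 + (p + ι * F t) * x' + (c + w t ι) := by
      funext j'; rw [hV]; ring
    rw [h]
    refine (((((hasDerivAt_id x).pow 2).const_mul (v₂ t)).add
      ((hasDerivAt_id x).const_mul (p + ι * F t))).add_const _).congr_deriv ?_
    simp; ring
  · intro rstar
    have hr : 2 * κ * rstar = -(2 * v₂ t * x + ι * F t) := by
      simp only [rstar]; field_simp
    refine ⟨⟨⟨rstar, rfl⟩, ?_⟩, ?_⟩
    · rintro y ⟨r, rfl⟩
      have : 0 ≤ κ * (r - rstar) ^ 2 := by positivity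
      linear_combination this + (rstar - r) * hr
    · simp only [rstar]
      field_simp
      ring
end
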